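/- arXiv:2209.11105 — 9 statements merged into one kernel-verified Lean document; each statement's English description precedes it below -/
import Mathlib

section
/- Let c, d be real numbers with c < 0, d < 0 and c ≠ d, set γ = −(c + d), and let h(t) = (exp(c·t) − exp(d·t))/(c − d). Then for every real τ ≥ 0, the improper integral ∫₀^∞ h(t)·h(t + τ) dt converges and equals −[(1/(2c) + 1/γ)·exp(c·τ) + (1/(2d) + 1/γ)·exp(d·τ)]/(c − d)². -/
open MeasureTheory

/-- Closed form of the autocorrelation of the overdamped kernel:
`∫₀^∞ h(t) h(t+τ) dt = -[(1/(2c)+1/γ)e^{cτ} + (1/(2d)+1/γ)e^{dτ}]/(c-d)²`. -/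
theorem overdamped_autocorrelation_closed_form
    (c d : ℝ) (hc : c < 0) (hd : d < 0) (hcd : c ≠ d)
    (γ : ℝ) (hγ : γ = -(c + d))
    (h : ℝ → ℝ)
    (hh : h = fun t => (Real.exp (c * t) - Real.exp (d * t)) / (c - d))
    (τ : ℝ) (hτ : 0 ≤ τ) :
    IntegrableOn (fun t => h t * h (t + τ)) (Set.Ioi 0) volume ∧
    ∫ t in Set.Ioi (0 : ℝ), h t * h (t + τ) =
      -(((1 / (2 * c) + 1 / γ) * Real.exp (c * τ)
        + (1 / (2 * d) + 1 / γ) * Real.exp (d * τ)) / (c - d) ^ 2) := by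
  have hcd' : c - d ≠ 0 := sub_ne_zero.mpr hcd
  have hsum : c + d < 0 := add_neg hc hd
  have hprod : (fun t => h t * h (t + τ)) = fun t =>
      (Real.exp (c * τ) / (c - d) ^ 2) * Real.exp (2 * c * t)
        + (Real.exp (d * τ) / (c - d) ^ 2) * Real.exp (2 * d * t)
        - ((Real.exp (c * τ) + Real.exp (d * τ)) / (c - d) ^ 2) * Real.exp ((c + d) * t) := by
    funext t
    have e₁ : Real.exp (2 * c * t) = Real.exp (c * t) * Real.exp (c * t) := by
      rw [← Real.exp_add]; ring_nf
    have e₂ : Real.exp (2 * d * t) = Real.exp (d * t) * Real.exp (d * t) := by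
      rw [← Real.exp_add]; ring_nf
    have e₃ : Real.exp ((c + d) * t) = Real.exp (c * t) * Real.exp (d * t) := by
      rw [← Real.exp_add]; ring_nf
    simp only [hh, e₁, e₂, e₃, mul_add, Real.exp_add]
    field_simp
    ring
  have hint {a : ℝ} (ha : a < 0) (K : ℝ) :
      IntegrableOn (fun t => K * Real.exp (a * t)) (Set.Ioi 0) volume :=
    (integrableOn_exp_mul_Ioi ha 0).const_mul K
  have hc₂ : 2 * c < 0 := by linarith
  have hd₂ : 2 * d < 0 := by linarith
  rw [hprod]
  refine ⟨((hint hc₂ _).add (hint hd₂ _)).sub (hint hsum _), ?_⟩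
  rw [integral_sub, integral_add (hint hc₂ _) (hint hd₂ _)]
  rotate_left
  · exact (hint hc₂ _).add (hint hd₂ _)
  · exact hint hsum _
  simp only [integral_const_mul, integral_exp_mul_Ioi hc₂, integral_exp_mul_Ioi hd₂,
    integral_exp_mul_Ioi hsum, mul_zero, Real.exp_zero, hγ, div_neg]
  ring
end

section
/- Let c, d be real numbers with c < 0, d < 0 and c ≠ d, set γ = −(c + d), and let h(t) = (exp(c·t) − exp(d·t))/(c − d). Define C(τ) = ∫₀^∞ h(t)·h(t + τ) dt for τ ≥ 0. Then C is differentiable on [0, ∞) and C'(τ) = −(1/(2γ))·h(τ) for every τ ≥ 0. -/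
open MeasureTheory

/-- Closed form of the autocorrelation of the overdamped kernel. -/
theorem integral_overdamped_mul_shift {c d : ℝ} (hc : c < 0) (hd : d < 0) (hcd : c ≠ d) (τ : ℝ) :
    ∫ t in Set.Ioi (0 : ℝ), (Real.exp (c * t) - Real.exp (d * t)) / (c - d) *
        ((Real.exp (c * (t + τ)) - Real.exp (d * (t + τ))) / (c - d)) =
      (Real.exp (c * τ) / c - Real.exp (d * τ) / d) / (2 * (c + d) * (c - d)) := by
  have hcc : 2 * c < 0 := by linarith
  have hdd : 2 * d < 0 := by linarith
  have hsum : c + d < 0 := by linarith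
  have hsub : c - d ≠ 0 := sub_ne_zero.mpr hcd
  have hexpand : ∀ t : ℝ, (Real.exp (c * t) - Real.exp (d * t)) / (c - d) *
        ((Real.exp (c * (t + τ)) - Real.exp (d * (t + τ))) / (c - d)) =
      Real.exp (c * τ) / (c - d) ^ 2 * (Real.exp (2 * c * t) - Real.exp ((c + d) * t)) +
        Real.exp (d * τ) / (c - d) ^ 2 * (Real.exp (2 * d * t) - Real.exp ((c + d) * t)) := by
    intro t
    rw [show 2 * c * t = c * t + c * t by ring, show 2 * d * t = d * t + d * t by ring]
    simp only [mul_add, add_mul, Real.exp_add]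
    field_simp
    ring
  have integrable_exp {a : ℝ} (ha : a < 0) :
      IntegrableOn (fun t : ℝ => Real.exp (a * t)) (Set.Ioi 0) := integrableOn_exp_mul_Ioi ha 0
  have integrable_diff {a : ℝ} (ha : a < 0) (k : ℝ) :
      IntegrableOn (fun t : ℝ => k * (Real.exp (a * t) - Real.exp ((c + d) * t))) (Set.Ioi 0) :=
    ((integrable_exp ha).sub (integrable_exp hsum)).const_mul k
  simp_rw [hexpand]
  rw [integral_add (integrable_diff hcc _) (integrable_diff hdd _),
    integral_const_mul, integral_const_mul,
    integral_sub (integrable_exp hcc) (integrable_exp hsum),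
    integral_sub (integrable_exp hdd) (integrable_exp hsum),
    integral_exp_mul_Ioi hcc, integral_exp_mul_Ioi hdd, integral_exp_mul_Ioi hsum]
  simp only [mul_zero, Real.exp_zero]
  field_simp [hc.ne, hd.ne, hsum.ne]
  ring

/-- Derivative of the autocorrelation of the overdamped angle kernel recovers the
kernel itself: `C'(τ) = -(1/(2γ)) h(τ)` on `[0, ∞)`. -/
theorem overdamped_autocorrelation_deriv
    (c d : ℝ) (hc : c < 0) (hd : d < 0) (hcd : c ≠ d)
    (γ : ℝ) (hγ : γ = -(c + d))
    (h : ℝ → ℝ)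
    (hh : h = fun t => (Real.exp (c * t) - Real.exp (d * t)) / (c - d))
    (C : ℝ → ℝ)
    (hC : ∀ τ : ℝ, 0 ≤ τ → C τ = ∫ t in Set.Ioi (0 : ℝ), h t * h (t + τ)) :
    ∀ τ : ℝ, 0 ≤ τ →
      HasDerivWithinAt C (-(1 / (2 * γ)) * h τ) (Set.Ici 0) τ := by
  subst hγ hh
  intro τ hτ
  have hsub : c - d ≠ 0 := sub_ne_zero.mpr hcd
  have hsum : c + d ≠ 0 := by linarith
  have hasDerivAt_exp {a : ℝ} (ha : a < 0) :
      HasDerivAt (fun x : ℝ => Real.exp (a * x) / a) (Real.exp (a * τ)) τ := by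
    refine ((((hasDerivAt_id' τ).const_mul a).exp).div_const a).congr_deriv ?_
    field_simp [ha.ne]
  have hderiv := ((hasDerivAt_exp hc).sub (hasDerivAt_exp hd)).div_const (2 * (c + d) * (c - d))
  have hclosed : ∀ x ∈ Set.Ici (0 : ℝ),
      C x = (Real.exp (c * x) / c - Real.exp (d * x) / d) / (2 * (c + d) * (c - d)) :=
    fun x hx => (hC x hx).trans (integral_overdamped_mul_shift hc hd hcd x)
  refine (hderiv.hasDerivWithinAt.congr_deriv ?_).congr hclosed (hclosed τ hτ)
  rw [mul_neg, one_div, inv_neg, neg_neg]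
  field_simp
end

section
/- Let c, d be real numbers with c < 0, d < 0 and c ≠ d, set γ = −(c + d), and let h(t) = (exp(c·t) − exp(d·t))/(c − d). Then for every real τ ≥ 0, ∫₀^∞ h(t)·h'(t + τ) dt = −(1/(2γ))·h(τ). -/
open MeasureTheory

/-- The integral over the positive half-line of a combination of three decaying exponentials. -/
theorem integral_Ioi_three_exp {a b e : ℝ} (ha : a < 0) (hb : b < 0) (he : e < 0) (p q r : ℝ) :
    ∫ t in Set.Ioi (0 : ℝ), (p * Real.exp (a * t) + q * Real.exp (b * t) + r * Real.exp (e * t)) =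
      -(p / a) - q / b - r / e := by
  have ia := (integrableOn_exp_mul_Ioi ha 0).const_mul p
  have ib := (integrableOn_exp_mul_Ioi hb 0).const_mul q
  have ie := (integrableOn_exp_mul_Ioi he 0).const_mul r
  rw [integral_add (by exact ia.add ib) ie, integral_add ia ib]
  simp only [integral_const_mul, integral_exp_mul_Ioi ha, integral_exp_mul_Ioi hb,
    integral_exp_mul_Ioi he, mul_zero, Real.exp_zero]
  ring

/-- The derivative of the overdamped impulse-response kernel. -/
theorem hasDerivAt_overdamped_kernel (c d t : ℝ) :
    HasDerivAt (fun t => (Real.exp (c * t) - Real.exp (d * t)) / (c - d))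
      ((c * Real.exp (c * t) - d * Real.exp (d * t)) / (c - d)) t := by
  have exp_deriv (a : ℝ) : HasDerivAt (fun t => Real.exp (a * t)) (a * Real.exp (a * t)) t := by
    simpa [mul_comm] using ((hasDerivAt_id t).const_mul a).exp
  exact ((exp_deriv c).sub (exp_deriv d)).div_const (c - d)

/-- Cross-correlation of the angle kernel with the shifted frequency kernel `h'`:
`∫₀^∞ h(t) h'(t+τ) dt = -(1/(2γ)) h(τ)` for `τ ≥ 0`. -/
theorem overdamped_angle_freq_crosscorrelation
    (c d : ℝ) (hc : c < 0) (hd : d < 0) (hcd : c ≠ d)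
    (γ : ℝ) (hγ : γ = -(c + d))
    (h : ℝ → ℝ)
    (hh : h = fun t => (Real.exp (c * t) - Real.exp (d * t)) / (c - d)) :
    ∀ τ : ℝ, 0 ≤ τ →
      ∫ t in Set.Ioi (0 : ℝ), h t * deriv h (t + τ) = -(1 / (2 * γ)) * h τ := by
  subst hγ hh
  intro τ _
  have hne : c - d ≠ 0 := sub_ne_zero.mpr hcd
  have hs : c + d < 0 := add_neg hc hd
  set C := Real.exp (c * τ) with hC
  set D := Real.exp (d * τ) with hD
  have expand (t : ℝ) :
      (Real.exp (c * t) - Real.exp (d * t)) / (c - d) *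
          deriv (fun t => (Real.exp (c * t) - Real.exp (d * t)) / (c - d)) (t + τ) =
        c * C / (c - d) ^ 2 * Real.exp (2 * c * t) +
          -(c * C + d * D) / (c - d) ^ 2 * Real.exp ((c + d) * t) +
          d * D / (c - d) ^ 2 * Real.exp (2 * d * t) := by
    rw [(hasDerivAt_overdamped_kernel c d (t + τ)).deriv, mul_add, mul_add, add_mul,
      Real.exp_add, Real.exp_add, Real.exp_add, ← hC, ← hD, mul_assoc 2 c, mul_assoc 2 d,
      two_mul (c * t), two_mul (d * t), Real.exp_add, Real.exp_add]
    field_simp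
    ring
  simp only [expand]
  rw [integral_Ioi_three_exp (by linarith) hs (by linarith)]
  have hc0 := hc.ne
  have hd0 := hd.ne
  have hs0 := hs.ne
  field_simp
  ring
end

section
/- Let c, d be real numbers with c < 0, d < 0 and c ≠ d, set γ = −(c + d), and let h(t) = (exp(c·t) − exp(d·t))/(c − d). Then for every real τ ≥ 0, ∫₀^∞ h'(t)·h(t + τ) dt = (1/(2γ))·h(τ). -/
open MeasureTheory

lemma deriv_exp_sub_exp_div (c d t : ℝ) :
    deriv (fun t => (Real.exp (c * t) - Real.exp (d * t)) / (c - d)) t =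
      (c * Real.exp (c * t) - d * Real.exp (d * t)) / (c - d) := by
  have hexp (a : ℝ) : HasDerivAt (fun t => Real.exp (a * t)) (a * Real.exp (a * t)) t := by
    simpa [mul_comm] using ((hasDerivAt_id t).const_mul a).exp
  exact (((hexp c).sub (hexp d)).div_const (c - d)).deriv

lemma integral_Ioi_zero_three_exp {p q r : ℝ} (hp : p < 0) (hq : q < 0) (hr : r < 0)
    (A B C : ℝ) :
    ∫ t in Set.Ioi (0 : ℝ), (A * Real.exp (p * t) + B * Real.exp (q * t) + C * Real.exp (r * t)) =
      -(A / p + B / q + C / r) := by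
  have hint {a : ℝ} (ha : a < 0) (K : ℝ) :
      IntegrableOn (fun t => K * Real.exp (a * t)) (Set.Ioi 0) :=
    (integrableOn_exp_mul_Ioi ha 0).const_mul K
  have hpq : IntegrableOn (fun t => A * Real.exp (p * t) + B * Real.exp (q * t)) (Set.Ioi 0) :=
    (hint hp A).add (hint hq B)
  rw [integral_add hpq (hint hr C), integral_add (hint hp A) (hint hq B)]
  simp only [integral_const_mul, integral_exp_mul_Ioi hp, integral_exp_mul_Ioi hq,
    integral_exp_mul_Ioi hr, mul_zero, Real.exp_zero]
  ring

/-- Cross-correlation of the frequency kernel `h'` with the shifted angle kernel: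
`∫₀^∞ h'(t) h(t+τ) dt = (1/(2γ)) h(τ)` for `τ ≥ 0`. -/
theorem overdamped_freq_angle_crosscorrelation
    (c d : ℝ) (hc : c < 0) (hd : d < 0) (hcd : c ≠ d)
    (γ : ℝ) (hγ : γ = -(c + d))
    (h : ℝ → ℝ)
    (hh : h = fun t => (Real.exp (c * t) - Real.exp (d * t)) / (c - d)) :
    ∀ τ : ℝ, 0 ≤ τ →
      ∫ t in Set.Ioi (0 : ℝ), deriv h t * h (t + τ) = (1 / (2 * γ)) * h τ := by
  intro τ _
  subst hh hγ
  have hsub : c - d ≠ 0 := sub_ne_zero.mpr hcd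
  have hexpand (t : ℝ) :
      (c * Real.exp (c * t) - d * Real.exp (d * t)) / (c - d) *
        ((Real.exp (c * (t + τ)) - Real.exp (d * (t + τ))) / (c - d)) =
      c * Real.exp (c * τ) / (c - d) ^ 2 * Real.exp ((2 * c) * t) +
        d * Real.exp (d * τ) / (c - d) ^ 2 * Real.exp ((2 * d) * t) +
        -(c * Real.exp (d * τ) + d * Real.exp (c * τ)) / (c - d) ^ 2 *
          Real.exp ((c + d) * t) := by
    simp only [mul_add, add_mul, two_mul, Real.exp_add]
    field_simp
    ring
  simp only [deriv_exp_sub_exp_div, hexpand]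
  rw [integral_Ioi_zero_three_exp (by linarith) (by linarith) (by linarith)]
  have hadd : c + d ≠ 0 := (add_neg hc hd).ne
  have hc0 := hc.ne
  have hd0 := hd.ne
  field_simp
  ring
end

section
/- Let c, d be real numbers with c < 0, d < 0 and c ≠ d, set γ = −(c + d), and let h(t) = (exp(c·t) − exp(d·t))/(c − d). Define C(τ) = ∫₀^∞ h(t)·h(t + τ) dt for τ ≥ 0. Then C is twice differentiable on [0, ∞) and C''(τ) = −(1/(2γ))·h'(τ) for every τ ≥ 0. -/
open MeasureTheory

/-- The integral over the positive half-line of the product of a difference of two decaying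
exponentials with a linear combination of them. -/
lemma integral_exp_sub_exp_mul_Ioi {c d : ℝ} (hc : c < 0) (hd : d < 0) (a b : ℝ) :
    ∫ t in Set.Ioi (0 : ℝ),
        (Real.exp (c * t) - Real.exp (d * t)) * (a * Real.exp (c * t) - b * Real.exp (d * t)) =
      -a / (2 * c) + (a + b) / (c + d) - b / (2 * d) := by
  have hcc : c + c < 0 := by linarith
  have hcd : c + d < 0 := by linarith
  have hdd : d + d < 0 := by linarith
  have int_c := (integrableOn_exp_mul_Ioi hcc 0).const_mul a
  have int_cd := (integrableOn_exp_mul_Ioi hcd 0).const_mul (a + b)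
  have int_d := (integrableOn_exp_mul_Ioi hdd 0).const_mul b
  have expand : ∀ t : ℝ,
      (Real.exp (c * t) - Real.exp (d * t)) * (a * Real.exp (c * t) - b * Real.exp (d * t)) =
        a * Real.exp ((c + c) * t) - (a + b) * Real.exp ((c + d) * t) +
          b * Real.exp ((d + d) * t) := by
    intro t
    simp only [add_mul, Real.exp_add]
    ring
  simp only [expand]
  rw [integral_add (int_c.sub' int_cd) int_d, integral_sub int_c int_cd]
  simp only [integral_const_mul, integral_exp_mul_Ioi hcc, integral_exp_mul_Ioi hcd,
    integral_exp_mul_Ioi hdd, mul_zero, Real.exp_zero]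
  ring

/-- The autocorrelation of the overdamped angle kernel is twice differentiable on
`[0, ∞)` with `C''(τ) = -(1/(2γ)) h'(τ)`. -/
theorem overdamped_autocorrelation_second_deriv
    (c d : ℝ) (hc : c < 0) (hd : d < 0) (hcd : c ≠ d)
    (γ : ℝ) (hγ : γ = -(c + d))
    (h : ℝ → ℝ)
    (hh : h = fun t => (Real.exp (c * t) - Real.exp (d * t)) / (c - d))
    (C : ℝ → ℝ)
    (hC : ∀ τ : ℝ, 0 ≤ τ → C τ = ∫ t in Set.Ioi (0 : ℝ), h t * h (t + τ)) :
    ∃ C₁ : ℝ → ℝ,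
      (∀ τ : ℝ, 0 ≤ τ → HasDerivWithinAt C (C₁ τ) (Set.Ici 0) τ) ∧
      (∀ τ : ℝ, 0 ≤ τ →
        HasDerivWithinAt C₁ (-(1 / (2 * γ)) * deriv h τ) (Set.Ici 0) τ) := by
  have hc0 : c ≠ 0 := hc.ne
  have hd0 : d ≠ 0 := hd.ne
  have hsub : c - d ≠ 0 := sub_ne_zero.mpr hcd
  have hadd : c + d ≠ 0 := by linarith
  have hasDerivAt_exp (a τ : ℝ) :
      HasDerivAt (fun t => Real.exp (a * t)) (Real.exp (a * τ) * a) τ := by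
    simpa using ((hasDerivAt_id τ).const_mul a).exp
  have C_eq : ∀ τ : ℝ, 0 ≤ τ → C τ =
      -(1 / (2 * γ)) * ((Real.exp (c * τ) / c - Real.exp (d * τ) / d) / (c - d)) := by
    intro τ hτ
    have expand : ∀ t : ℝ, h t * h (t + τ) = ((c - d) ^ 2)⁻¹ *
        ((Real.exp (c * t) - Real.exp (d * t)) *
          (Real.exp (c * τ) * Real.exp (c * t) - Real.exp (d * τ) * Real.exp (d * t))) := by
      intro t
      simp only [hh, mul_add, Real.exp_add]
      field_simp
    rw [hC τ hτ]
    simp only [expand]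
    rw [integral_const_mul, integral_exp_sub_exp_mul_Ioi hc hd, hγ]
    have hneg : -(c + d) ≠ 0 := neg_ne_zero.mpr hadd
    field_simp
    ring
  refine ⟨fun τ => -(1 / (2 * γ)) * h τ, fun τ hτ => ?_, fun τ _ => ?_⟩
  · refine HasDerivWithinAt.congr (HasDerivAt.hasDerivWithinAt ?_) C_eq (C_eq τ hτ)
    have deriv_eq := ((((hasDerivAt_exp c τ).div_const c).fun_sub
      ((hasDerivAt_exp d τ).div_const d)).div_const (c - d)).const_mul (-(1 / (2 * γ)))
    simpa only [hh, mul_div_cancel_right₀ _ hc0, mul_div_cancel_right₀ _ hd0] using deriv_eq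
  · have diff : DifferentiableAt ℝ h τ := by
      rw [hh]
      fun_prop
    exact (diff.hasDerivAt.const_mul _).hasDerivWithinAt
end

section
/- Let γ > 0 and λ > γ²/4 be real numbers, set ω = √(λ − γ²/4), and let h(t) = exp(−γ·t/2)·sin(ω·t)/ω. Define C(τ) = ∫₀^∞ h(t)·h(t + τ) dt for τ ≥ 0. Then C is differentiable on [0, ∞) and C'(τ) = −(1/(2γ))·h(τ) for every τ ≥ 0. -/
open MeasureTheory

/-- An exponentially damped cosine is integrable on the half-line. -/
lemma integrableOn_exp_neg_mul_cos {a : ℝ} (ha : 0 < a) (b φ : ℝ) :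
    IntegrableOn (fun t : ℝ => Real.exp (-a * t) * Real.cos (b * t + φ)) (Set.Ioi 0) := by
  refine Integrable.mono' (exp_neg_integrableOn_Ioi 0 ha)
    (Continuous.aestronglyMeasurable (by fun_prop)) (Filter.Eventually.of_forall fun t => ?_)
  rw [norm_mul, Real.norm_eq_abs, Real.norm_eq_abs, Real.abs_exp]
  exact mul_le_of_le_one_right (Real.exp_pos _).le (Real.abs_cos_le_one _)

/-- The integral of an exponentially damped cosine over the half-line. -/
lemma integral_exp_neg_mul_cos {a : ℝ} (ha : 0 < a) (b φ : ℝ) :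
    ∫ t in Set.Ioi (0 : ℝ), Real.exp (-a * t) * Real.cos (b * t + φ) =
      (a * Real.cos φ - b * Real.sin φ) / (a ^ 2 + b ^ 2) := by
  have hD : a ^ 2 + b ^ 2 ≠ 0 := by positivity
  let F : ℝ → ℝ := fun t => Real.exp (-a * t) *
    ((b * Real.sin (b * t + φ) - a * Real.cos (b * t + φ)) / (a ^ 2 + b ^ 2))
  have hderiv : ∀ t ∈ Set.Ici (0 : ℝ),
      HasDerivAt F (Real.exp (-a * t) * Real.cos (b * t + φ)) t := by
    intro t _
    have hlin : HasDerivAt (fun t : ℝ => b * t + φ) b t := by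
      simpa using ((hasDerivAt_id t).const_mul b).add_const φ
    have hexp : HasDerivAt (fun t : ℝ => Real.exp (-a * t)) (Real.exp (-a * t) * -a) t := by
      simpa using ((hasDerivAt_id t).const_mul (-a)).exp
    refine (hexp.mul (((hlin.sin.const_mul b).sub (hlin.cos.const_mul a)).div_const
      (a ^ 2 + b ^ 2))).congr_deriv ?_
    simp only [Pi.sub_apply]
    field_simp
    ring
  have hexp_lim : Filter.Tendsto (fun t : ℝ => Real.exp (-a * t)) Filter.atTop (nhds 0) :=
    Real.tendsto_exp_atBot.comp (Filter.tendsto_id.const_mul_atTop_of_neg (neg_lt_zero.mpr ha))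
  have hlim : Filter.Tendsto F Filter.atTop (nhds 0) := by
    refine hexp_lim.zero_mul_isBoundedUnder_le ?_
    refine Filter.isBoundedUnder_of ⟨(|b| + |a|) / (a ^ 2 + b ^ 2), fun t => ?_⟩
    simp only [Function.comp_apply, Real.norm_eq_abs, abs_div]
    rw [abs_of_pos (by positivity : 0 < a ^ 2 + b ^ 2)]
    gcongr
    refine (abs_sub _ _).trans (add_le_add ?_ ?_) <;> rw [abs_mul]
    · exact mul_le_of_le_one_right (abs_nonneg _) (Real.abs_sin_le_one _)
    · exact mul_le_of_le_one_right (abs_nonneg _) (Real.abs_cos_le_one _)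
  rw [integral_Ioi_of_hasDerivAt_of_tendsto' hderiv (integrableOn_exp_neg_mul_cos ha b φ) hlim]
  simp only [F, mul_zero, zero_add, Real.exp_zero, one_mul]
  ring

/-- The closed form of the autocorrelation of an exponentially damped sine. -/
lemma integral_dampedSine_mul_shift {γ ω : ℝ} (hγ : 0 < γ) (hω : 0 < ω) (τ : ℝ) :
    ∫ t in Set.Ioi (0 : ℝ), Real.exp (-γ * t / 2) * Real.sin (ω * t) / ω *
        (Real.exp (-γ * (t + τ) / 2) * Real.sin (ω * (t + τ)) / ω) =
      Real.exp (-γ / 2 * τ) * (2 * ω * Real.cos (ω * τ) + γ * Real.sin (ω * τ)) /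
        (γ * ω * (γ ^ 2 + 4 * ω ^ 2)) := by
  have hsplit : ∀ t : ℝ, Real.exp (-γ * t / 2) * Real.sin (ω * t) / ω *
      (Real.exp (-γ * (t + τ) / 2) * Real.sin (ω * (t + τ)) / ω) =
      Real.exp (-γ / 2 * τ) / (2 * ω ^ 2) *
        (Real.cos (ω * τ) * (Real.exp (-γ * t) * Real.cos (0 * t + 0)) -
          Real.exp (-γ * t) * Real.cos (2 * ω * t + ω * τ)) := by
    intro t
    have hexp : Real.exp (-γ * t / 2) * Real.exp (-γ * (t + τ) / 2) =
        Real.exp (-γ / 2 * τ) * Real.exp (-γ * t) := by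
      rw [← Real.exp_add, ← Real.exp_add]
      ring_nf
    have htrig : 2 * (Real.sin (ω * t) * Real.sin (ω * (t + τ))) =
        Real.cos (ω * τ) - Real.cos (2 * ω * t + ω * τ) := by
      have h₁ := Real.cos_sub (ω * (t + τ)) (ω * t)
      have h₂ := Real.cos_add (ω * (t + τ)) (ω * t)
      rw [show ω * (t + τ) - ω * t = ω * τ by ring] at h₁
      rw [show ω * (t + τ) + ω * t = 2 * ω * t + ω * τ by ring] at h₂
      rw [h₁, h₂]
      ring
    calc
      _ = Real.exp (-γ * t / 2) * Real.exp (-γ * (t + τ) / 2) *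
          (2 * (Real.sin (ω * t) * Real.sin (ω * (t + τ)))) / (2 * ω ^ 2) := by
        field_simp
      _ = _ := by
        rw [hexp, htrig, zero_mul, zero_add, Real.cos_zero]
        ring
  simp_rw [hsplit]
  rw [integral_const_mul, integral_sub ((integrableOn_exp_neg_mul_cos hγ 0 0).const_mul _)
    (integrableOn_exp_neg_mul_cos hγ (2 * ω) (ω * τ)), integral_const_mul,
    integral_exp_neg_mul_cos hγ, integral_exp_neg_mul_cos hγ, Real.cos_zero, Real.sin_zero,
    show γ ^ 2 + (2 * ω) ^ 2 = γ ^ 2 + 4 * ω ^ 2 by ring]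
  have hD : γ ^ 2 + 4 * ω ^ 2 ≠ 0 := by positivity
  field_simp
  ring



/-- Underdamped regime: the derivative of the autocorrelation of the angle kernel
`h(t) = e^{-γt/2} sin(ωt)/ω` recovers the kernel: `C'(τ) = -(1/(2γ)) h(τ)` on `[0, ∞)`. -/
theorem underdamped_autocorrelation_deriv
    (γ lam : ℝ) (hγ : 0 < γ) (hlam : γ ^ 2 / 4 < lam)
    (ω : ℝ) (hω : ω = Real.sqrt (lam - γ ^ 2 / 4))
    (h : ℝ → ℝ)
    (hh : h = fun t => Real.exp (-γ * t / 2) * Real.sin (ω * t) / ω)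
    (C : ℝ → ℝ)
    (hC : ∀ τ : ℝ, 0 ≤ τ → C τ = ∫ t in Set.Ioi (0 : ℝ), h t * h (t + τ)) :
    ∀ τ : ℝ, 0 ≤ τ →
      HasDerivWithinAt C (-(1 / (2 * γ)) * h τ) (Set.Ici 0) τ := by
  have hω_pos : 0 < ω := hω ▸ Real.sqrt_pos.mpr (sub_pos.mpr hlam)
  have hC_closed : ∀ τ ∈ Set.Ici (0 : ℝ), C τ =
      Real.exp (-γ / 2 * τ) * (2 * ω * Real.cos (ω * τ) + γ * Real.sin (ω * τ)) /
        (γ * ω * (γ ^ 2 + 4 * ω ^ 2)) := by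
    intro τ hτ
    rw [hC τ hτ, hh]
    exact integral_dampedSine_mul_shift hγ hω_pos τ
  intro τ hτ
  refine HasDerivWithinAt.congr ?_ hC_closed (hC_closed τ hτ)
  have hlin : HasDerivAt (fun t : ℝ => ω * t) ω τ := by
    simpa using (hasDerivAt_id τ).const_mul ω
  have hexp : HasDerivAt (fun t : ℝ => Real.exp (-γ / 2 * t))
      (Real.exp (-γ / 2 * τ) * (-γ / 2)) τ := by
    simpa using ((hasDerivAt_id τ).const_mul (-γ / 2)).exp
  refine (((hexp.mul ((hlin.cos.const_mul (2 * ω)).add (hlin.sin.const_mul γ))).div_const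
    (γ * ω * (γ ^ 2 + 4 * ω ^ 2))).congr_deriv ?_).hasDerivWithinAt
  have hD : γ ^ 2 + 4 * ω ^ 2 ≠ 0 := by positivity
  simp only [hh, Pi.add_apply, show -γ * τ / 2 = -γ / 2 * τ by ring]
  generalize Real.exp (-γ / 2 * τ) = E
  field_simp
  ring
end

section
/- Let γ > 0 and λ > γ²/4 be real numbers, set ω = √(λ − γ²/4), let h(t) = exp(−γ·t/2)·sin(ω·t)/ω, and let g = h'. Then for every real τ ≥ 0, ∫₀^∞ g(t)·g(t + τ) dt = (1/(2γ))·g(τ). -/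
open MeasureTheory

/-- If `g = h'` and `g' = -γ g - l h`, and both `h` and `g` decay exponentially, then the
autocorrelation of `g` is given by the boundary term of the energy form `g g + l h h`. -/
theorem integral_Ioi_mul_shift_of_damped_oscillator {γ l C : ℝ} (hγ : 0 < γ) {h g : ℝ → ℝ}
    (hh : ∀ t, HasDerivAt h (g t) t) (hg : ∀ t, HasDerivAt g (-γ * g t - l * h t) t)
    (hhC : ∀ t, |h t| ≤ C * Real.exp (-(γ / 2) * t))
    (hgC : ∀ t, |g t| ≤ C * Real.exp (-(γ / 2) * t)) {τ : ℝ} :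
    ∫ t in Set.Ioi (0 : ℝ), g t * g (t + τ) =
      (1 / (2 * γ)) * (g 0 * g τ + l * (h 0 * h τ)) := by
  have hexp : Filter.Tendsto (fun t : ℝ => C * Real.exp (-(γ / 2) * t)) Filter.atTop
      (nhds 0) := by
    have h1 : Filter.Tendsto (fun t : ℝ => -(γ / 2) * t) Filter.atTop Filter.atBot :=
      Filter.tendsto_id.const_mul_atTop_of_neg (by linarith)
    simpa using (Real.tendsto_exp_atBot.comp h1).const_mul C
  have hh0 : Filter.Tendsto h Filter.atTop (nhds 0) := squeeze_zero_norm hhC hexp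
  have hg0 : Filter.Tendsto g Filter.atTop (nhds 0) := squeeze_zero_norm hgC hexp
  have hshift : Filter.Tendsto (fun t : ℝ => t + τ) Filter.atTop Filter.atTop :=
    Filter.tendsto_atTop_add_const_right _ _ Filter.tendsto_id
  have hgcont : Continuous g := continuous_iff_continuousAt.2 fun t => (hg t).continuousAt
  have hint : IntegrableOn (fun t => g t * g (t + τ)) (Set.Ioi 0) := by
    have hdom := (integrableOn_exp_mul_Ioi (a := -γ) (by linarith) 0).const_mul
      (C * C * Real.exp (-(γ / 2) * τ))
    refine hdom.mono' (by fun_prop) (Filter.Eventually.of_forall fun t => ?_)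
    rw [Real.norm_eq_abs, abs_mul]
    refine (mul_le_mul (hgC t) (hgC (t + τ)) (abs_nonneg _)
      ((abs_nonneg _).trans (hgC t))).trans_eq ?_
    rw [show -γ * t = -(γ / 2) * t + -(γ / 2) * t by ring, mul_add, Real.exp_add, Real.exp_add]
    ring
  have hderiv : ∀ t ∈ Set.Ici (0 : ℝ), HasDerivAt
      (fun t => -(1 / (2 * γ)) * (g t * g (t + τ) + l * (h t * h (t + τ))))
      (g t * g (t + τ)) t := by
    intro t _
    have hG := (hg (t + τ)).comp_add_const t τ
    have hH := (hh (t + τ)).comp_add_const t τ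
    convert! (((hg t).mul hG).add (((hh t).mul hH).const_mul l)).const_mul
      (-(1 / (2 * γ))) using 1
    field_simp
    ring
  have hlim : Filter.Tendsto
      (fun t => -(1 / (2 * γ)) * (g t * g (t + τ) + l * (h t * h (t + τ))))
      Filter.atTop (nhds 0) := by
    simpa using ((hg0.mul (hg0.comp hshift)).add
      ((hh0.mul (hh0.comp hshift)).const_mul l)).const_mul (-(1 / (2 * γ)))
  rw [integral_Ioi_of_hasDerivAt_of_tendsto' hderiv hint hlim, zero_add]
  ring

/-- Underdamped regime: the autocorrelation of the frequency kernel `g = h'` is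
proportional to the kernel: `∫₀^∞ g(t) g(t+τ) dt = (1/(2γ)) g(τ)` for `τ ≥ 0`. -/
theorem underdamped_freq_autocorrelation
    (γ lam : ℝ) (hγ : 0 < γ) (hlam : γ ^ 2 / 4 < lam)
    (ω : ℝ) (hω : ω = Real.sqrt (lam - γ ^ 2 / 4))
    (h : ℝ → ℝ)
    (hh : h = fun t => Real.exp (-γ * t / 2) * Real.sin (ω * t) / ω)
    (g : ℝ → ℝ) (hg : g = deriv h) :
    ∀ τ : ℝ, 0 ≤ τ →
      ∫ t in Set.Ioi (0 : ℝ), g t * g (t + τ) = (1 / (2 * γ)) * g τ := by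
  intro τ _
  have hω0 : 0 < ω := hω ▸ Real.sqrt_pos.2 (by linarith)
  have hlam' : lam = ω ^ 2 + γ ^ 2 / 4 := by
    rw [hω, Real.sq_sqrt (by linarith)]
    ring
  have hE (t : ℝ) : HasDerivAt (fun t => Real.exp (-γ * t / 2))
      (Real.exp (-γ * t / 2) * (-γ / 2)) t := by
    simpa using (((hasDerivAt_id t).const_mul (-γ)).div_const 2).exp
  have hS (t : ℝ) : HasDerivAt (fun t => Real.sin (ω * t)) (Real.cos (ω * t) * ω) t := by
    simpa using ((hasDerivAt_id t).const_mul ω).sin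
  have hK (t : ℝ) : HasDerivAt (fun t => Real.cos (ω * t)) (-Real.sin (ω * t) * ω) t := by
    simpa using ((hasDerivAt_id t).const_mul ω).cos
  have hh' (t : ℝ) : HasDerivAt h
      (Real.exp (-γ * t / 2) * (Real.cos (ω * t) - γ / (2 * ω) * Real.sin (ω * t))) t := by
    rw [hh]
    convert! ((hE t).mul (hS t)).div_const ω using 1
    field_simp
    ring
  have hg' : g = fun t =>
      Real.exp (-γ * t / 2) * (Real.cos (ω * t) - γ / (2 * ω) * Real.sin (ω * t)) := by
    rw [hg]
    exact funext fun t => (hh' t).deriv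
  have hgd (t : ℝ) : HasDerivAt g (-γ * g t - lam * h t) t := by
    rw [hg', hh, hlam']
    convert! (hE t).mul ((hK t).sub ((hS t).const_mul (γ / (2 * ω)))) using 1
    simp only [Pi.sub_apply]
    field_simp
    ring
  have hexp (t : ℝ) : -γ * t / 2 = -(γ / 2) * t := by ring
  have hsin (t : ℝ) : |Real.sin (ω * t)| ≤ 1 := Real.abs_sin_le_one _
  have hcos (t : ℝ) : |Real.cos (ω * t)| ≤ 1 := Real.abs_cos_le_one _
  have hc : 0 < γ / (2 * ω) := by positivity
  have hω' : 0 < 1 / ω := by positivity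
  have key := integral_Ioi_mul_shift_of_damped_oscillator (C := 1 / ω + (1 + γ / (2 * ω)))
    (τ := τ) hγ (fun t => by simpa only [hg'] using hh' t) hgd
    (fun t => by
      simp only [hh]
      rw [hexp, mul_div_assoc, abs_mul, Real.abs_exp, mul_comm, abs_div, abs_of_pos hω0]
      gcongr
      have := div_le_div_of_nonneg_right (hsin t) hω0.le
      linarith)
    (fun t => by
      simp only [hg']
      rw [hexp, abs_mul, Real.abs_exp, mul_comm]
      gcongr
      have h1 := abs_sub (Real.cos (ω * t)) (γ / (2 * ω) * Real.sin (ω * t))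
      rw [abs_mul, abs_of_pos hc] at h1
      have h2 := mul_le_mul_of_nonneg_left (hsin t) hc.le
      linarith [hcos t])
  have hh0 : h 0 = 0 := by simp [hh]
  have hg0 : g 0 = 1 := by simp [hg']
  rw [key, hh0, hg0]
  ring
end

section
/- Let γ > 0 and λ > γ²/4 be real numbers, set ω = √(λ − γ²/4), and let h(t) = exp(−γ·t/2)·sin(ω·t)/ω. Then for every real τ ≥ 0, the improper integral ∫₀^∞ h(t)·h(t + τ) dt converges and equals (1/(2γλ))·exp(−γ·τ/2)·(cos(ω·τ) + (γ/(2ω))·sin(ω·τ)). -/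
open MeasureTheory

theorem integrableOn_Ioi_exp_neg_mul_cos {a : ℝ} (ha : 0 < a) (b θ : ℝ) :
    IntegrableOn (fun t => Real.exp (-a * t) * Real.cos (b * t + θ)) (Set.Ioi 0) volume := by
  refine (exp_neg_integrableOn_Ioi 0 ha).mono' (by fun_prop) (.of_forall fun t => ?_)
  rw [norm_mul, Real.norm_eq_abs, Real.abs_exp]
  exact mul_le_of_le_one_right (Real.exp_pos _).le (Real.abs_cos_le_one _)

theorem integral_Ioi_exp_neg_mul_cos {a : ℝ} (ha : 0 < a) (b θ : ℝ) :
    ∫ t in Set.Ioi (0 : ℝ), Real.exp (-a * t) * Real.cos (b * t + θ) =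
      (a * Real.cos θ - b * Real.sin θ) / (a ^ 2 + b ^ 2) := by
  have hab : a ^ 2 + b ^ 2 ≠ 0 := by positivity
  have hderiv : ∀ t ∈ Set.Ici (0 : ℝ), HasDerivAt
      (fun t => Real.exp (-a * t) *
        ((-a * Real.cos (b * t + θ) + b * Real.sin (b * t + θ)) / (a ^ 2 + b ^ 2)))
      (Real.exp (-a * t) * Real.cos (b * t + θ)) t := by
    intro t _
    have hexp := ((hasDerivAt_id' t).const_mul (-a)).exp
    have hlin := ((hasDerivAt_id' t).const_mul b).add_const θ
    refine (hexp.mul (((hlin.cos.const_mul (-a)).add (hlin.sin.const_mul b)).div_const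
      (a ^ 2 + b ^ 2))).congr_deriv ?_
    simp only [Pi.add_apply]
    field_simp
    ring
  have hexp : Filter.Tendsto (fun t : ℝ => Real.exp (-a * t)) Filter.atTop (nhds 0) :=
    Real.tendsto_exp_atBot.comp
      (Filter.tendsto_id.const_mul_atTop_of_neg (neg_lt_zero.mpr ha))
  have hlim : Filter.Tendsto (fun t => Real.exp (-a * t) *
      ((-a * Real.cos (b * t + θ) + b * Real.sin (b * t + θ)) / (a ^ 2 + b ^ 2)))
      Filter.atTop (nhds 0) := by
    refine hexp.zero_mul_isBoundedUnder_le
      (Filter.isBoundedUnder_of ⟨(|a| + |b|) / |a ^ 2 + b ^ 2|, fun t => ?_⟩)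
    simp only [Function.comp_apply, Real.norm_eq_abs, abs_div]
    gcongr
    refine (abs_add_le _ _).trans ?_
    rw [abs_mul, abs_mul, abs_neg]
    exact add_le_add (mul_le_of_le_one_right (abs_nonneg _) (Real.abs_cos_le_one _))
      (mul_le_of_le_one_right (abs_nonneg _) (Real.abs_sin_le_one _))
  rw [integral_Ioi_of_hasDerivAt_of_tendsto' hderiv
    (integrableOn_Ioi_exp_neg_mul_cos ha b θ) hlim]
  simp only [mul_zero, Real.exp_zero, zero_add]
  ring

/-- Closed form of the autocorrelation of the underdamped kernel:
`∫₀^∞ h(t) h(t+τ) dt = (1/(2γλ)) e^{-γτ/2} (cos(ωτ) + (γ/(2ω)) sin(ωτ))`. -/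
theorem underdamped_autocorrelation_closed_form
    (γ lam : ℝ) (hγ : 0 < γ) (hlam : γ ^ 2 / 4 < lam)
    (ω : ℝ) (hω : ω = Real.sqrt (lam - γ ^ 2 / 4))
    (h : ℝ → ℝ)
    (hh : h = fun t => Real.exp (-γ * t / 2) * Real.sin (ω * t) / ω)
    (τ : ℝ) (hτ : 0 ≤ τ) :
    IntegrableOn (fun t => h t * h (t + τ)) (Set.Ioi 0) volume ∧
    ∫ t in Set.Ioi (0 : ℝ), h t * h (t + τ) =
      (1 / (2 * γ * lam)) * Real.exp (-γ * τ / 2)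
        * (Real.cos (ω * τ) + (γ / (2 * ω)) * Real.sin (ω * τ)) := by
  have hωpos : 0 < ω := hω ▸ Real.sqrt_pos.mpr (sub_pos.mpr hlam)
  have hlam_eq : lam = ω ^ 2 + γ ^ 2 / 4 := by
    rw [hω, Real.sq_sqrt (sub_pos.mpr hlam).le]
    ring
  have hprod : (fun t => h t * h (t + τ)) = fun t =>
      Real.exp (-γ * τ / 2) / (2 * ω ^ 2) *
        (Real.exp (-γ * t) * Real.cos (0 * t + ω * τ) -
          Real.exp (-γ * t) * Real.cos (2 * ω * t + ω * τ)) := by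
    funext t
    have hexp : Real.exp (-γ * t / 2) * Real.exp (-γ * (t + τ) / 2) =
        Real.exp (-γ * τ / 2) * Real.exp (-γ * t) := by
      rw [← Real.exp_add, ← Real.exp_add]
      ring_nf
    have hsin : 2 * (Real.sin (ω * t) * Real.sin (ω * (t + τ))) =
        Real.cos (0 * t + ω * τ) - Real.cos (2 * ω * t + ω * τ) := by
      rw [← mul_assoc, Real.two_mul_sin_mul_sin, ← Real.cos_neg (ω * t - ω * (t + τ))]
      ring_nf
    rw [hh, ← mul_sub, ← hsin]
    linear_combination Real.sin (ω * t) * Real.sin (ω * (t + τ)) / ω ^ 2 * hexp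
  have hconst := integrableOn_Ioi_exp_neg_mul_cos hγ 0 (ω * τ)
  have hosc := integrableOn_Ioi_exp_neg_mul_cos hγ (2 * ω) (ω * τ)
  rw [hprod]
  refine ⟨(hconst.sub hosc).const_mul _, ?_⟩
  rw [integral_const_mul, integral_sub hconst hosc, integral_Ioi_exp_neg_mul_cos hγ,
    integral_Ioi_exp_neg_mul_cos hγ, hlam_eq]
  have hden : γ ^ 2 + (2 * ω) ^ 2 ≠ 0 := by positivity
  have hden' : ω ^ 2 + γ ^ 2 / 4 ≠ 0 := by positivity
  field_simp
  ring
end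

section
/- Let γ > 0 and α > 0 be real, let V be an invertible real N×N matrix, and let λ₁, …, λ_N be real numbers with 0 < λᵢ < γ²/4 for all i; set cᵢ = −γ/2 + √(γ²/4 − λᵢ), dᵢ = −γ/2 − √(γ²/4 − λᵢ), and hᵢ(t) = (exp(cᵢ·t) − exp(dᵢ·t))/(cᵢ − dᵢ). Define the matrix functions T(τ) = V·diag(h₁(τ), …, h_N(τ))·Vᵀ and C(τ) = α·V·diag(∫₀^∞ h₁(t)h₁(t+τ)dt, …, ∫₀^∞ h_N(t)h_N(t+τ)dt)·Vᵀ for τ ≥ 0. Then C is differentiable on [0, ∞) and, entrywise, C'(τ) = −(α/(2γ))·T(τ) for every τ ≥ 0; equivalently, T(τ) = −(2γ/α)·C'(τ). -/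
open Matrix MeasureTheory

/-- Autocorrelation over `[0, ∞)` of the impulse response of an overdamped oscillator with
negative real characteristic roots `c ≠ d`. -/
theorem integral_exp_sub_exp_autocorrelation {c d : ℝ} (hc : c < 0) (hd : d < 0) (hcd : c ≠ d)
    (τ : ℝ) :
    ∫ t in Set.Ioi (0 : ℝ), (Real.exp (c * t) - Real.exp (d * t)) / (c - d) *
        ((Real.exp (c * (t + τ)) - Real.exp (d * (t + τ))) / (c - d)) =
      (2 * (c - d) * (c + d))⁻¹ * (Real.exp (c * τ) / c - Real.exp (d * τ) / d) := by
  have hsub : c - d ≠ 0 := sub_ne_zero.mpr hcd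
  have hsum : c + d < 0 := add_neg hc hd
  have hexp (t : ℝ) : (Real.exp (c * t) - Real.exp (d * t)) / (c - d) *
        ((Real.exp (c * (t + τ)) - Real.exp (d * (t + τ))) / (c - d)) =
      ((c - d) ^ 2)⁻¹ * (Real.exp (c * τ) * Real.exp (2 * c * t)
        - (Real.exp (c * τ) + Real.exp (d * τ)) * Real.exp ((c + d) * t)
        + Real.exp (d * τ) * Real.exp (2 * d * t)) := by
    have h₁ : Real.exp (2 * c * t) = Real.exp (c * t) * Real.exp (c * t) := by
      rw [← Real.exp_add]; ring_nf
    have h₂ : Real.exp (2 * d * t) = Real.exp (d * t) * Real.exp (d * t) := by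
      rw [← Real.exp_add]; ring_nf
    rw [h₁, h₂, add_mul c d t, mul_add c, mul_add d, Real.exp_add, Real.exp_add, Real.exp_add]
    field_simp
    ring
  have hint (a K : ℝ) (ha : a < 0) :
      Integrable (fun t => K * Real.exp (a * t)) (volume.restrict (Set.Ioi 0)) :=
    (integrableOn_exp_mul_Ioi ha 0).const_mul K
  have hc2 : 2 * c < 0 := by linarith
  have hd2 : 2 * d < 0 := by linarith
  simp_rw [hexp]
  rw [integral_const_mul, integral_add (by exact (hint _ _ hc2).sub (hint _ _ hsum)) (hint _ _ hd2),
    integral_sub (hint _ _ hc2) (hint _ _ hsum), integral_const_mul, integral_const_mul,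
    integral_const_mul, integral_exp_mul_Ioi hc2, integral_exp_mul_Ioi hsum,
    integral_exp_mul_Ioi hd2]
  simp only [mul_zero, Real.exp_zero]
  have := hc.ne
  have := hd.ne
  have := hsum.ne
  field_simp
  ring

/-- The autocorrelation is differentiable, with derivative a multiple of the impulse response. -/
theorem hasDerivAt_exp_sub_exp_autocorrelation {c d : ℝ} (hc : c < 0) (hd : d < 0) (hcd : c ≠ d)
    (τ : ℝ) :
    HasDerivAt (fun s => ∫ t in Set.Ioi (0 : ℝ),
        (Real.exp (c * t) - Real.exp (d * t)) / (c - d) *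
        ((Real.exp (c * (t + s)) - Real.exp (d * (t + s))) / (c - d)))
      ((2 * (c + d))⁻¹ * ((Real.exp (c * τ) - Real.exp (d * τ)) / (c - d))) τ := by
  simp_rw [integral_exp_sub_exp_autocorrelation hc hd hcd]
  have hexp (a : ℝ) (ha : a < 0) :
      HasDerivAt (fun s => Real.exp (a * s) / a) (Real.exp (a * τ)) τ := by
    have := (((hasDerivAt_id τ).const_mul a).exp).div_const a
    simpa [ha.ne] using this
  refine (((hexp c hc).sub (hexp d hd)).const_mul _).congr_deriv ?_
  have := sub_ne_zero.mpr hcd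
  have := (add_neg hc hd).ne
  field_simp

/-- Matrix form of Proposition 1 (Angle Response): with `T(τ) = V diag(hᵢ(τ)) Vᵀ` and
`C(τ) = α · V diag(∫₀^∞ hᵢ(t)hᵢ(t+τ)dt) Vᵀ`, the entrywise derivative satisfies
`C'(τ) = -(α/(2γ)) T(τ)` on `[0, ∞)`, i.e. `T(τ) = -(2γ/α) C'(τ)`. -/
theorem angle_response_matrix_form
    (N : ℕ) (γ α : ℝ) (hγ : 0 < γ) (hα : 0 < α)
    (V : Matrix (Fin N) (Fin N) ℝ) (hV : IsUnit V)
    (lam : Fin N → ℝ) (hlam : ∀ i, 0 < lam i ∧ lam i < γ ^ 2 / 4)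
    (c d : Fin N → ℝ)
    (hc : ∀ i, c i = -γ / 2 + Real.sqrt (γ ^ 2 / 4 - lam i))
    (hd : ∀ i, d i = -γ / 2 - Real.sqrt (γ ^ 2 / 4 - lam i))
    (h : Fin N → ℝ → ℝ)
    (hh : ∀ i, h i = fun t =>
      (Real.exp (c i * t) - Real.exp (d i * t)) / (c i - d i))
    (T C : ℝ → Matrix (Fin N) (Fin N) ℝ)
    (hT : ∀ τ : ℝ, T τ = V * Matrix.diagonal (fun i => h i τ) * Vᵀ)
    (hC : ∀ τ : ℝ, 0 ≤ τ → C τ = α •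
      (V * Matrix.diagonal
        (fun i => ∫ t in Set.Ioi (0 : ℝ), h i t * h i (t + τ)) * Vᵀ)) :
    ∀ τ : ℝ, 0 ≤ τ → ∀ k l : Fin N,
      HasDerivWithinAt (fun s => C s k l)
        (-(α / (2 * γ)) * T τ k l) (Set.Ici 0) τ := by
  intro τ hτ k l
  have hmodal (i : Fin N) :
      HasDerivAt (fun s => ∫ t in Set.Ioi (0 : ℝ), h i t * h i (t + s))
        (-(1 / (2 * γ)) * h i τ) τ := by
    obtain ⟨hpos, hlt⟩ := hlam i
    have hsqrt : 0 < Real.sqrt (γ ^ 2 / 4 - lam i) := Real.sqrt_pos.mpr (by linarith)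
    have hsqrt_lt : Real.sqrt (γ ^ 2 / 4 - lam i) < γ / 2 := by
      rw [Real.sqrt_lt' (by linarith)]
      linarith [show (γ / 2) ^ 2 = γ ^ 2 / 4 by ring]
    have hci : c i < 0 := by rw [hc]; linarith
    have hdi : d i < 0 := by rw [hd]; linarith
    have hcd : c i ≠ d i := by rw [hc, hd]; linarith
    have hsum : c i + d i = -γ := by rw [hc, hd]; ring
    simp only [hh]
    refine (hasDerivAt_exp_sub_exp_autocorrelation hci hdi hcd τ).congr_deriv ?_
    rw [hsum]
    field_simp
  have hderiv : HasDerivAt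
      (fun s => α * ∑ i, V k i * (∫ t in Set.Ioi (0 : ℝ), h i t * h i (t + s)) * V l i)
      (α * ∑ i, V k i * (-(1 / (2 * γ)) * h i τ) * V l i) τ :=
    (HasDerivAt.fun_sum fun i _ => ((hmodal i).const_mul (V k i)).mul_const (V l i)).const_mul α
  have hCentry (s : ℝ) (hs : s ∈ Set.Ici (0 : ℝ)) :
      C s k l = α * ∑ i, V k i * (∫ t in Set.Ioi (0 : ℝ), h i t * h i (t + s)) * V l i := by
    rw [hC s hs, Matrix.smul_apply, smul_eq_mul, Matrix.mul_apply]
    simp only [Matrix.mul_diagonal, Matrix.transpose_apply]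
  refine (hderiv.hasDerivWithinAt.congr hCentry (hCentry τ hτ)).congr_deriv ?_
  rw [hT, Matrix.mul_apply, Finset.mul_sum, Finset.mul_sum]
  refine Finset.sum_congr rfl fun i _ => ?_
  simp only [Matrix.mul_diagonal, Matrix.transpose_apply]
  ring
end
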